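/- Suppose ν ≤ μ < κ are infinite cardinals, μ^{<ν} = μ, and (κ⁺,κ) ↠ (μ⁺,μ). Then (κ⁺,κ) ↠_ν (μ⁺,μ). -/

import Mathlib

open Cardinal Ordinal

/-- Chang's Conjecture `(κ₁,κ₀) ↠ (μ₁,μ₀)`: every structure in a countable first-order
language on the set of ordinals below the initial ordinal of `κ₁` has a substructure of
cardinality `μ₁` whose intersection with the ordinals below the initial ordinal of `κ₀`
has cardinality `μ₀`. -/
def ChangCC (κ₁ κ₀ μ₁ μ₀ : Cardinal.{0}) : Prop :=
  ∀ (L : FirstOrder.Language.{0,0}) (_ : Countable L.Symbols) (_ : L.Structure (Set.Iio κ₁.ord)),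
    ∃ B : L.Substructure (Set.Iio κ₁.ord),
      #B = Cardinal.lift.{1,0} μ₁ ∧
      #{x : Set.Iio κ₁.ord // x ∈ B ∧ x.val < κ₀.ord} = Cardinal.lift.{1,0} μ₀

/-- Chang's Conjecture with subscript, `(κ₁,κ₀) ↠_ν (μ₁,μ₀)`: additionally the substructure
contains every ordinal below the initial ordinal of `ν`. -/
def ChangCCSub (κ₁ κ₀ μ₁ μ₀ ν : Cardinal.{0}) : Prop :=
  ∀ (L : FirstOrder.Language.{0,0}) (_ : Countable L.Symbols) (_ : L.Structure (Set.Iio κ₁.ord)),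
    ∃ B : L.Substructure (Set.Iio κ₁.ord),
      #B = Cardinal.lift.{1,0} μ₁ ∧
      #{x : Set.Iio κ₁.ord // x ∈ B ∧ x.val < κ₀.ord} = Cardinal.lift.{1,0} μ₀ ∧
      ∀ x : Set.Iio κ₁.ord, x.val < ν.ord → x ∈ B

namespace BC

inductive Tm (F : Type) : Type
  | fst : Tm F
  | snd : Tm F
  | zero : Tm F
  | op (f : F) : Tm F
  | pr (s t : Tm F) : Tm F
  | cp (s t : Tm F) : Tm F
  | dl (t : Tm F) : Tm F
deriving Countable

section
universe u
variable {X : Type u} [LinearOrder X] [WellFoundedLT X] {F : Type}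

open Classical in
noncomputable def tr (K : Set X) (o x : X) : X := if x ∈ K then x else o

open Classical in
noncomputable def least (o : X) (S : Set X) : X :=
  if h : S.Nonempty then wellFounded_lt.min S h else o

noncomputable def ev (p : X × X ≃ X) (K : Set X) (o : X) (g : F → X → X) : Tm F → X → X
  | .fst => fun x => (p.symm x).1
  | .snd => fun x => (p.symm x).2
  | .zero => fun _ => o
  | .op f => g f
  | .pr s t => fun x => p (ev p K o g s x, ev p K o g t x)
  | .cp s t => fun x => ev p K o g s (ev p K o g t x)
  | .dl t => fun x => least o {a | tr K o (ev p K o g t (p (a, (p.symm x).1))) ≠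
      tr K o (ev p K o g t (p (a, (p.symm x).2)))}

inductive Cl (p : X × X ≃ X) (K : Set X) (o : X) (g : F → X → X) (A : Set X) : X → Prop
  | base (x : X) (h : x ∈ A) : Cl p K o g A x
  | app (t : Tm F) (x : X) (h : Cl p K o g A x) : Cl p K o g A (ev p K o g t x)
  | pair (x y : X) (h : Cl p K o g A x) (h' : Cl p K o g A y) : Cl p K o g A (p (x, y))

variable {p : X × X ≃ X} {K : Set X} {o : X} {g : F → X → X}

theorem Cl.mono {A B : Set X} (h : A ⊆ B) {x : X} (hx : Cl p K o g A x) : Cl p K o g B x := by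
  induction hx with
  | base x hx => exact .base _ (h hx)
  | app t x _ ih => exact .app _ _ ih
  | pair x y _ _ ih ih' => exact .pair _ _ ih ih'

theorem cl_succ {B : Set X} (hB : B.Nonempty) (d : X) {x : X}
    (hx : Cl p K o g (B ∪ Set.Iic d) x) :
    ∃ t, ∃ b, Cl p K o g (B ∪ Set.Iio d) b ∧ x = ev p K o g t (p (d, b)) := by
  obtain ⟨b0, hb0⟩ := hB
  induction hx with
  | base x hx =>
    by_cases h : x = d
    · subst h
      exact ⟨.fst, b0, .base _ (Or.inl hb0), by simp [ev]⟩
    · refine ⟨.snd, x, .base _ ?_, by simp [ev]⟩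
      rcases hx with hx | hx
      · exact Or.inl hx
      · exact Or.inr (lt_of_le_of_ne hx h)
  | app t x _ ih =>
    obtain ⟨s, b, hb, rfl⟩ := ih
    exact ⟨.cp t s, b, hb, rfl⟩
  | pair x y _ _ ih ih' =>
    obtain ⟨s, b, hb, rfl⟩ := ih
    obtain ⟨s', b', hb', rfl⟩ := ih'
    exact ⟨.pr (.cp s (.pr .fst (.cp .fst .snd))) (.cp s' (.pr .fst (.cp .snd .snd))),
      p (b, b'), .pair _ _ hb hb', by simp [ev]⟩

theorem cl_absorb {B : Set X} {d : X} (hdC : Cl p K o g (B ∪ Set.Iio d) d) {x : X}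
    (hx : Cl p K o g (B ∪ Set.Iic d) x) : Cl p K o g (B ∪ Set.Iio d) x := by
  induction hx with
  | base x hx =>
    by_cases h : x = d
    · rw [h]; exact hdC
    · refine .base _ ?_
      rcases hx with hx | hx
      · exact Or.inl hx
      · exact Or.inr (lt_of_le_of_ne hx h)
  | app t x _ ih => exact .app _ _ ih
  | pair x y _ _ ih ih' => exact .pair _ _ ih ih'

theorem cl_union {B : Set X} (c : X) {x : X}
    (hx : Cl p K o g (B ∪ Set.Iio c) x) :
    Cl p K o g B x ∨ ∃ d < c, Cl p K o g (B ∪ Set.Iic d) x := by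
  induction hx with
  | base x hx =>
    rcases hx with hx | hx
    · exact Or.inl (.base _ hx)
    · exact Or.inr ⟨x, hx, .base _ (Or.inr (le_refl x))⟩
  | app t x _ ih =>
    rcases ih with ih | ⟨d, hd, ih⟩
    · exact Or.inl (.app _ _ ih)
    · exact Or.inr ⟨d, hd, .app _ _ ih⟩
  | pair x y _ _ ih ih' =>
    rcases ih with ih | ⟨d, hd, ih⟩ <;> rcases ih' with ih' | ⟨d', hd', ih'⟩
    · exact Or.inl (.pair _ _ ih ih')
    · exact Or.inr ⟨d', hd', .pair _ _ (ih.mono Set.subset_union_left) ih'⟩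
    · exact Or.inr ⟨d, hd, .pair _ _ ih (ih'.mono Set.subset_union_left)⟩
    · refine Or.inr ⟨max d d', max_lt hd hd', .pair _ _ (ih.mono ?_) (ih'.mono ?_)⟩
      · exact Set.union_subset_union_right _ (Set.Iic_subset_Iic.2 (le_max_left _ _))
      · exact Set.union_subset_union_right _ (Set.Iic_subset_Iic.2 (le_max_right _ _))

/-- key counting step -/
theorem key (hoK : o ∈ K) {C : Set X} (hne : C.Nonempty)
    (happ : ∀ t x, x ∈ C → ev p K o g t x ∈ C)
    (hpair : ∀ x y, x ∈ C → y ∈ C → p (x, y) ∈ C) (d : X) (hd : Set.Iio d ⊆ C) (hdC : d ∉ C)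
    (M : Cardinal.{u}) (hC : #(C ∩ K : Set X) ≤ M) (hM : M ^ #(Set.Iio d) ≤ M) (t : Tm F) :
    #{y | ∃ b ∈ C, y = tr K o (ev p K o g t (p (d, b)))} ≤ M := by
  have hoC : o ∈ C := by obtain ⟨c, hc⟩ := hne; exact happ .zero c hc
  have htr : ∀ x ∈ C, tr K o x ∈ C ∩ K := by
    intro x hx
    unfold tr
    split_ifs with h
    · exact ⟨hx, h⟩
    · exact ⟨hoC, hoK⟩
  let Φ : C → (Set.Iio d → (C ∩ K : Set X)) := fun b a =>
    ⟨tr K o (ev p K o g t (p (a, b))), htr _ (happ _ _ (hpair _ _ (hd a.2) b.2))⟩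
  have hdep : ∀ b b' : C, Φ b = Φ b' →
      tr K o (ev p K o g t (p (d, b))) = tr K o (ev p K o g t (p (d, b'))) := by
    intro b b' h
    by_contra hcon
    set S : Set X := {a | tr K o (ev p K o g t (p (a, b))) ≠ tr K o (ev p K o g t (p (a, b')))}
      with hS
    have hSne : S.Nonempty := ⟨d, hcon⟩
    have hmem : least o S ∈ C := by
      have := happ (.dl t) (p (b, b')) (hpair _ _ b.2 b'.2)
      simpa [ev] using this
    have hl : least o S = wellFounded_lt.min S hSne := by simp [least, hSne]
    rw [hl] at hmem
    have h1 : wellFounded_lt.min S hSne ∈ S := wellFounded_lt.min_mem S hSne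
    have h2 : ¬ d < wellFounded_lt.min S hSne := wellFounded_lt.not_lt_min S hcon
    rcases lt_or_eq_of_le (not_lt.1 h2) with h3 | h3
    · apply h1
      exact congrArg Subtype.val (congrFun h ⟨_, h3⟩)
    · rw [h3] at hmem
      exact hdC hmem
  refine le_trans ?_ (le_trans (Cardinal.power_le_power_right hC) hM)
  rw [Cardinal.power_def]
  let f : {y | ∃ b ∈ C, y = tr K o (ev p K o g t (p (d, b)))} → (Set.Iio d → (C ∩ K : Set X)) :=
    fun y => Φ ⟨y.2.choose, y.2.choose_spec.1⟩
  refine Cardinal.mk_le_of_injective (f := f) ?_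
  intro y y' h
  apply Subtype.ext
  rw [y.2.choose_spec.2, y'.2.choose_spec.2]
  exact hdep _ _ h

theorem union_bd {Y ι : Type u} (A : ι → Set Y) (M : Cardinal.{u}) (hM : ℵ₀ ≤ M) (hι : #ι ≤ M)
    (h : ∀ i, #(A i) ≤ M) : #(⋃ i, A i : Set Y) ≤ M := by
  have h1 := Cardinal.mk_iUnion_le A
  have h2 : (⨆ i, #(A i)) ≤ M := ciSup_le' h
  calc _ ≤ _ := h1
    _ ≤ M * M := mul_le_mul' hι h2
    _ = M := Cardinal.mul_eq_self hM

theorem main [Countable F] (hoK : o ∈ K) {B : Set X} (hne : B.Nonempty)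
    (happ : ∀ t x, x ∈ B → ev p K o g t x ∈ B)
    (hpair : ∀ x y, x ∈ B → y ∈ B → p (x, y) ∈ B)
    (M N : Cardinal.{u}) (hM : ℵ₀ ≤ M) (hMN : M ≤ N)
    (hBK : #(B ∩ K : Set X) ≤ M) (hB : #B ≤ N) (e : X)
    (he : #(Set.Iio e) ≤ M) (hpow : ∀ d < e, M ^ #(Set.Iio d) ≤ M) :
    ∀ c ≤ e, #({x | Cl p K o g (B ∪ Set.Iio c) x} ∩ K : Set X) ≤ M ∧
      #{x | Cl p K o g (B ∪ Set.Iio c) x} ≤ N := by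
  intro c
  induction c using WellFoundedLT.induction with
  | ind c ih =>
  intro hce
  have hT : #(ULift.{u} (Tm F)) ≤ ℵ₀ := by
    rw [Cardinal.mk_le_aleph0_iff]; infer_instance
  have hN : ℵ₀ ≤ N := hM.trans hMN
  have hcl : ∀ x, Cl p K o g B x → x ∈ B := by
    intro x hx
    induction hx with
    | base x h => exact h
    | app t x _ ih => exact happ _ _ ih
    | pair x y _ _ ih ih' => exact hpair _ _ ih ih'
  have hstep : ∀ d < c, #({x | Cl p K o g (B ∪ Set.Iic d) x} ∩ K : Set X) ≤ M ∧
      #{x | Cl p K o g (B ∪ Set.Iic d) x} ≤ N := by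
    intro d hdc
    obtain ⟨i1, i2⟩ := ih d hdc (hdc.le.trans hce)
    set C : Set X := {x | Cl p K o g (B ∪ Set.Iio d) x} with hC
    have hCne : C.Nonempty := hne.mono fun x hx => Cl.base _ (Or.inl hx)
    constructor
    · by_cases hdC : d ∈ C
      · refine le_trans (Cardinal.mk_le_mk_of_subset ?_) i1
        rintro x ⟨hx, hxK⟩
        refine ⟨?_, hxK⟩
        exact cl_absorb hdC hx
      · have hk := key (p := p) (g := g) hoK hCne (fun t x hx => .app t x hx)
          (fun x y hx hy => .pair x y hx hy) d (fun a ha => .base _ (Or.inr ha)) hdC M i1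
          (hpow d (hdc.trans_le hce))
        have hsub : ({x | Cl p K o g (B ∪ Set.Iic d) x} ∩ K : Set X) ⊆
            ⋃ t : ULift.{u} (Tm F), {y | ∃ b ∈ C, y = tr K o (ev p K o g t.down (p (d, b)))} := by
          rintro x ⟨hx, hxK⟩
          obtain ⟨t, b, hb, rfl⟩ := cl_succ hne d hx
          exact Set.mem_iUnion.2 ⟨⟨t⟩, b, hb, by simp [tr, hxK]⟩
        exact (Cardinal.mk_le_mk_of_subset hsub).trans
          (union_bd _ M hM (hT.trans hM) fun t => hk t.down)
    · have hsub : {x | Cl p K o g (B ∪ Set.Iic d) x} ⊆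
          ⋃ t : ULift.{u} (Tm F), (fun b => ev p K o g t.down (p (d, b))) '' C := by
        intro x hx
        obtain ⟨t, b, hb, rfl⟩ := cl_succ hne d hx
        exact Set.mem_iUnion.2 ⟨⟨t⟩, b, hb, rfl⟩
      exact (Cardinal.mk_le_mk_of_subset hsub).trans
        (union_bd _ N hN (hT.trans hN) fun t => Cardinal.mk_image_le.trans i2)
  have hIc : #(Set.Iio c) ≤ M :=
    (Cardinal.mk_le_mk_of_subset (Set.Iio_subset_Iio hce)).trans he
  constructor
  · have hsub : ({x | Cl p K o g (B ∪ Set.Iio c) x} ∩ K : Set X) ⊆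
        (B ∩ K) ∪ ⋃ d : Set.Iio c, ({x | Cl p K o g (B ∪ Set.Iic d.1) x} ∩ K : Set X) := by
      rintro x ⟨hx, hxK⟩
      rcases cl_union c hx with h | ⟨d, hd, h⟩
      · exact Or.inl ⟨hcl _ h, hxK⟩
      · exact Or.inr (Set.mem_iUnion.2 ⟨⟨d, hd⟩, h, hxK⟩)
    refine (Cardinal.mk_le_mk_of_subset hsub).trans ((Cardinal.mk_union_le _ _).trans ?_)
    refine (add_le_add hBK (union_bd _ M hM hIc fun d => (hstep d.1 d.2).1)).trans ?_
    rw [Cardinal.add_eq_self hM]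
  · have hsub : {x | Cl p K o g (B ∪ Set.Iio c) x} ⊆
        B ∪ ⋃ d : Set.Iio c, {x | Cl p K o g (B ∪ Set.Iic d.1) x} := by
      intro x hx
      rcases cl_union c hx with h | ⟨d, hd, h⟩
      · exact Or.inl (hcl _ h)
      · exact Or.inr (Set.mem_iUnion.2 ⟨⟨d, hd⟩, h⟩)
    refine (Cardinal.mk_le_mk_of_subset hsub).trans ((Cardinal.mk_union_le _ _).trans ?_)
    refine (add_le_add hB (union_bd _ N hN (hIc.trans hMN) fun d => (hstep d.1 d.2).2)).trans ?_
    rw [Cardinal.add_eq_self hN]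

/-- coding of finite tuples -/
def enc (p : X × X ≃ X) (o : X) : (n : ℕ) → (Fin n → X) → X
  | 0, _ => o
  | n + 1, v => p (v 0, enc p o n (fun i => v i.succ))

def dec (p : X × X ≃ X) : (n : ℕ) → X → (Fin n → X)
  | 0, _ => Fin.elim0
  | n + 1, x => Fin.cons (p.symm x).1 (dec p n (p.symm x).2)

theorem dec_enc (p : X × X ≃ X) (o : X) (n : ℕ) (v : Fin n → X) : dec p n (enc p o n v) = v := by
  induction n with
  | zero => exact funext fun i => i.elim0
  | succ n ih =>
    simp only [dec, enc, Equiv.symm_apply_apply, ih]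
    exact Fin.cons_self_tail v

theorem enc_mem {C : Set X} (hpair : ∀ x y, x ∈ C → y ∈ C → p (x, y) ∈ C) (ho : o ∈ C)
    (n : ℕ) (v : Fin n → X) (hv : ∀ i, v i ∈ C) : enc p o n v ∈ C := by
  induction n with
  | zero => exact ho
  | succ n ih => exact hpair _ _ (hv 0) (ih _ fun i => hv _)

end

def SF (F : Type) : ℕ → Type
  | 1 => Tm F
  | 2 => Unit
  | _ => Empty

def SL (F : Type) : FirstOrder.Language.{0,0} := ⟨SF F, fun _ => Empty⟩

instance (F : Type) [Countable F] : Countable (SL F).Symbols := by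
  have h1 : ∀ n, Countable ((SL F).Functions n) := by
    intro n
    match n with
    | 0 => exact inferInstanceAs (Countable Empty)
    | 1 => exact inferInstanceAs (Countable (Tm F))
    | 2 => exact inferInstanceAs (Countable Unit)
    | n + 3 => exact inferInstanceAs (Countable Empty)
  have h2 : ∀ n, Countable ((SL F).Relations n) := fun n => inferInstanceAs (Countable Empty)
  unfold FirstOrder.Language.Symbols
  infer_instance

noncomputable def SS {X : Type 1} [LinearOrder X] [WellFoundedLT X] {F : Type}
    (p : X × X ≃ X) (K : Set X) (o : X) (g : F → X → X) : (SL F).Structure X where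
  funMap := fun {n} => match n with
    | 0 => fun f => (f : Empty).elim
    | 1 => fun f v => ev p K o g f (v 0)
    | 2 => fun _ v => p (v 0, v 1)
    | _ + 3 => fun f => (f : Empty).elim
  RelMap := fun r => (r : Empty).elim

end BC

theorem bottomcard (κ μ ν : Cardinal.{0})
    (hν : ℵ₀ ≤ ν) (hνμ : ν ≤ μ) (hμκ : μ < κ)
    (hpow : μ ^< ν = μ)
    (hcc : ChangCC (Order.succ κ) κ (Order.succ μ) μ) :
    ChangCCSub (Order.succ κ) κ (Order.succ μ) μ ν := by
  intro L hL SL0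
  have hκ : ℵ₀ ≤ κ := (hν.trans hνμ).trans hμκ.le
  have hκs : ℵ₀ ≤ Order.succ κ := hκ.trans (Order.le_succ κ)
  let X := Set.Iio (Order.succ κ).ord
  have hXc : #X = Cardinal.lift.{1,0} (Order.succ κ) := by
    simp [X, Cardinal.mk_Iio_ordinal]
  have hXinf : ℵ₀ ≤ #X := by rw [hXc]; exact Cardinal.aleph0_le_lift.2 hκs
  obtain ⟨p⟩ : Nonempty (X × X ≃ X) := by
    rw [← Cardinal.eq, Cardinal.mk_prod]
    simpa using Cardinal.mul_eq_self hXinf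
  let K : Set X := {x | x.val < κ.ord}
  have hκpos : (0 : Ordinal) < κ.ord := by
    rw [Cardinal.lt_ord]; simpa using (Cardinal.aleph0_pos.trans_le hκ)
  have hκκ : κ.ord < (Order.succ κ).ord := Cardinal.ord_lt_ord.2 (Order.lt_succ κ)
  let o : X := ⟨0, hκpos.trans hκκ⟩
  let e : X := ⟨ν.ord, (Cardinal.ord_lt_ord.2 (hνμ.trans_lt hμκ)).trans hκκ⟩
  let F := Σ n, L.Functions n
  haveI : Countable F := by
    have : Function.Injective (Sum.inl : F → L.Symbols) := Sum.inl_injective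
    exact this.countable
  let g : F → X → X := fun f x => SL0.funMap f.2 (BC.dec p f.1 x)
  obtain ⟨B, hB1, hB2⟩ := hcc (BC.SL F) inferInstance (BC.SS p K o g)
  have happ : ∀ t x, x ∈ (B : Set X) → BC.ev p K o g t x ∈ (B : Set X) := by
    intro t x hx
    exact @FirstOrder.Language.Substructure.fun_mem _ _ (BC.SS p K o g) B 1 t (fun _ => x) (fun _ => hx)
  have hpair : ∀ x y, x ∈ (B : Set X) → y ∈ (B : Set X) → p (x, y) ∈ (B : Set X) := by
    intro x y hx hy
    exact @FirstOrder.Language.Substructure.fun_mem _ _ (BC.SS p K o g) B 2 () ![x, y]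
      (fun i => by fin_cases i <;> assumption)
  have hne : (B : Set X).Nonempty := by
    have : #B ≠ 0 := by
      rw [hB1]; simp
    exact Set.nonempty_coe_sort.1 (Cardinal.mk_ne_zero_iff.1 this)
  have hBK : #((B : Set X) ∩ K : Set X) = Cardinal.lift.{1,0} μ := hB2
  have hμ : ℵ₀ ≤ μ := hν.trans hνμ
  have hIio : ∀ d : X, #(Set.Iio d) = Cardinal.lift.{1,0} d.val.card := by
    intro d
    rw [← Cardinal.mk_Iio_ordinal]
    refine Cardinal.mk_congr ⟨fun a => ⟨a.1.1, a.2⟩, fun a => ⟨⟨a.1, lt_trans (Set.mem_Iio.1 a.2) (Set.mem_Iio.1 d.2)⟩, a.2⟩, ?_, ?_⟩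
    · intro a; rfl
    · intro a; rfl
  obtain ⟨h1, h2⟩ := BC.main (p := p) (K := K) (o := o) (g := g) hκpos hne happ hpair
    (Cardinal.lift.{1,0} μ) (Cardinal.lift.{1,0} (Order.succ μ)) (by simpa using hμ)
    (Cardinal.lift_le.2 (Order.le_succ μ)) hBK.le hB1.le e
    (by rw [hIio]; simpa [e] using hνμ)
    (by
      intro d hd
      rw [hIio, ← Cardinal.lift_power, Cardinal.lift_le]
      have : d.val.card < ν := Cardinal.lt_ord.1 hd
      exact (Cardinal.le_powerlt μ this).trans hpow.le) e le_rfl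
  set C : Set X := {x | BC.Cl p K o g ((B : Set X) ∪ Set.Iio e) x} with hC
  have hBC : (B : Set X) ⊆ C := fun x hx => .base _ (Or.inl hx)
  have hoC : o ∈ C := by
    obtain ⟨b, hb⟩ := hne
    exact .app .zero b (hBC hb)
  refine ⟨⟨C, ?_⟩, ?_, ?_, ?_⟩
  · intro n f v hv
    have := BC.Cl.app (.op ⟨n, f⟩) _ (BC.enc_mem (p := p) (o := o) (C := C)
      (fun x y hx hy => .pair x y hx hy) hoC n v hv)
    have h3 : BC.ev p K o g (.op ⟨n, f⟩) (BC.enc p o n v) = SL0.funMap f v := by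
      simp [BC.ev, g, BC.dec_enc]
    rw [h3] at this
    exact this
  · exact le_antisymm h2 (hB1.ge.trans (Cardinal.mk_le_mk_of_subset hBC))
  · exact le_antisymm h1 (hBK.ge.trans (Cardinal.mk_le_mk_of_subset
      (Set.inter_subset_inter_left _ hBC)))
  · intro x hx
    exact .base _ (Or.inr hx)
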